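/- arXiv:1012.4765 — 2 statements merged into one kernel-verified Lean document; each statement's English description precedes it below -/
import Mathlib

section
/- Let (X,δ) be a complete metrically star-shaped hemi-metric space and let T : X → X be non-expansive with respect to δ. Then inf_{y∈X} δ(y,T(y)) = ρ(T) = max_{h∈𝓜} inf_{x∈X} (h(T(x)) − h(x)), where the maximum over the Martin space 𝓜 is attained. Moreover, if δ is bounded from below and ρ(T) > 0, then any Martin function attaining the maximum is a horofunction. -/
open Filter Topology

section HemiMetric

variable {X : Type*} {δ : X → X → ℝ} {T : X → X}

theorem hemi_iterate_le (htri : ∀ x y z : X, δ x z ≤ δ x y + δ y z) (hself : ∀ x, δ x x = 0)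
    (hT : ∀ x y : X, δ (T x) (T y) ≤ δ x y) (y : X) (k : ℕ) :
    δ y (T^[k] y) ≤ k * δ y (T y) := by
  induction k with
  | zero => simp [hself]
  | succ k ih =>
    have h := htri y (T y) (T^[k + 1] y)
    have h' : δ (T y) (T^[k + 1] y) ≤ δ y (T^[k] y) := by
      rw [Function.iterate_succ_apply']
      exact hT _ _
    push_cast
    linarith

theorem hemi_iterate_nonexpansive (hT : ∀ x y : X, δ (T x) (T y) ≤ δ x y) (x y : X) (k : ℕ) :
    δ (T^[k] x) (T^[k] y) ≤ δ x y := by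
  induction k with
  | zero => simp
  | succ k ih =>
    simp only [Function.iterate_succ_apply']
    exact (hT _ _).trans ih

theorem hemi_orbit_le (htri : ∀ x y z : X, δ x z ≤ δ x y + δ y z) (hself : ∀ x, δ x x = 0)
    (hT : ∀ x y : X, δ (T x) (T y) ≤ δ x y) (x y : X) (k : ℕ) :
    δ x (T^[k] x) ≤ k * δ y (T y) + (δ x y + δ y x) := by
  have h₁ := htri x y (T^[k] x)
  have h₂ := htri y (T^[k] y) (T^[k] x)
  have h₃ := hemi_iterate_nonexpansive hT y x k
  have h₄ := hemi_iterate_le htri hself hT y k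
  linarith

theorem bddBelow_hemi_displacement (htri : ∀ x y z : X, δ x z ≤ δ x y + δ y z)
    (hself : ∀ x, δ x x = 0) (hT : ∀ x y : X, δ (T x) (T y) ≤ δ x y) (x : X) :
    BddBelow (Set.range fun y => δ y (T y)) := by
  refine ⟨-δ (T x) x, ?_⟩
  rintro _ ⟨y, rfl⟩
  by_contra! hlt
  obtain ⟨k, hk⟩ := exists_nat_gt ((δ x y + δ y x) / (-δ (T x) x - δ y (T y)))
  rw [div_lt_iff₀ (by linarith)] at hk
  have h₁ := hemi_orbit_le htri hself hT x y k
  have h₂ := hemi_iterate_le (δ := fun a b => δ b a)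
    (fun a b c => (htri c b a).trans_eq (add_comm _ _)) hself (fun a b => hT b a) x k
  have h₃ := htri x (T^[k] x) x
  simp only [hself] at h₂ h₃
  linarith

theorem martin_sub_le (htri : ∀ x y z : X, δ x z ≤ δ x y + δ y z) {b : X} {g : X → ℝ}
    (hg : g ∈ closure {f : X → ℝ | ∃ z : X, f = fun y => δ b z - δ y z}) (x y : X) :
    g y - g x ≤ δ x y := by
  have hclosed : IsClosed {f : X → ℝ | f y - f x ≤ δ x y} :=
    isClosed_le ((continuous_apply y).sub (continuous_apply x)) continuous_const
  refine closure_minimal ?_ hclosed hg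
  rintro _ ⟨z, rfl⟩
  have := htri x y z
  simp only [Set.mem_ofPred_eq]
  linarith

theorem exists_martin_tendsto (htri : ∀ x y z : X, δ x z ≤ δ x y + δ y z) (b : X) {ι : Type*}
    (U : Ultrafilter ι) (w : ι → X) :
    ∃ h ∈ closure {f : X → ℝ | ∃ z : X, f = fun y => δ b z - δ y z},
      ∀ y, Tendsto (fun s => δ b (w s) - δ y (w s)) U (𝓝 (h y)) := by
  have hK : IsCompact (Set.univ.pi fun y : X => Set.Icc (-δ y b) (δ b y)) :=
    isCompact_univ_pi fun _ => isCompact_Icc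
  obtain ⟨h, -, hh⟩ := hK.ultrafilter_le_nhds' (U.map fun s y => δ b (w s) - δ y (w s)) <| by
    refine Ultrafilter.mem_map.2 (Filter.univ_mem' fun s y _ => ?_)
    have h₁ := htri y b (w s)
    have h₂ := htri b y (w s)
    constructor <;> simp only <;> linarith
  have hlim : Tendsto (fun s y => δ b (w s) - δ y (w s)) U (𝓝 h) := hh
  exact ⟨h, mem_closure_of_tendsto hlim (Eventually.of_forall fun s => ⟨w s, rfl⟩),
    tendsto_pi_nhds.1 hlim⟩

theorem exists_fixedPoint_of_hemi_contraction {X : Type*} [MetricSpace X] [CompleteSpace X]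
    [Nonempty X] {δ : X → X → ℝ} (hdist : ∀ x y : X, dist x y = max (δ x y) (δ y x)) {s : ℝ}
    (hs0 : 0 ≤ s) (hs1 : s < 1) {F : X → X} (hF : ∀ x y, δ (F x) (F y) ≤ s * δ x y) :
    ∃ y, F y = y := by
  have hc : ContractingWith ⟨s, hs0⟩ F := by
    refine ⟨hs1, LipschitzWith.of_dist_le_mul fun x y => ?_⟩
    rw [hdist, hdist]
    refine max_le ((hF x y).trans ?_) ((hF y x).trans ?_)
    · exact mul_le_mul_of_nonneg_left (le_max_left _ _) hs0
    · exact mul_le_mul_of_nonneg_left (le_max_right _ _) hs0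
  exact ⟨_, hc.fixedPoint_isFixedPt⟩

theorem hemi_fixedPoint_sub_ge (htri : ∀ x y z : X, δ x z ≤ δ x y + δ y z)
    {x₀ : X} {γ : X → ℝ → X} (hγ0 : ∀ y : X, γ y 0 = x₀) (hγ1 : ∀ y : X, γ y 1 = y)
    (hgeo : ∀ (y : X) (s t : ℝ), 0 ≤ s → s ≤ t → t ≤ 1 →
      δ (γ y s) (γ y t) = (t - s) * δ x₀ y)
    (hconv : ∀ (y z : X) (s : ℝ), 0 ≤ s → s ≤ 1 → δ (γ y s) (γ z s) ≤ s * δ y z)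
    (hT : ∀ x y : X, δ (T x) (T y) ≤ δ x y) {s : ℝ} (hs0 : 0 ≤ s) (hs1 : s ≤ 1)
    {w : X} (hw : γ (T w) s = w) (x : X) :
    s * δ w (T w) - (1 - s) * δ x₀ x - δ (T x) (γ (T x) s) ≤ δ x w - δ (T x) w := by
  have h₁ : δ w (T w) = (1 - s) * δ x₀ (T w) := by
    simpa [hγ1, hw] using hgeo (T w) s 1 hs0 hs1 le_rfl
  have h₂ : δ x₀ w = s * δ x₀ (T w) := by
    simpa [hγ0, hw] using hgeo (T w) 0 s le_rfl hs0 hs1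
  have h₃ := htri (T x) (γ (T x) s) w
  have h₄ : δ (γ (T x) s) w ≤ s * δ x w := by
    have := hconv (T x) (T w) s hs0 hs1
    rw [hw] at this
    exact this.trans (mul_le_mul_of_nonneg_left (hT x w) hs0)
  have h₅ : s * δ w (T w) = (1 - s) * δ x₀ w := by rw [h₁, h₂]; ring
  have h₆ := mul_le_mul_of_nonneg_left (htri x₀ x w) (sub_nonneg.2 hs1)
  linarith

theorem mul_le_sub_iterate {h : X → ℝ} {c : ℝ} (hh : ∀ x, c ≤ h (T x) - h x) (x : X) (k : ℕ) :
    k * c ≤ h (T^[k] x) - h x := by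
  induction k with
  | zero => simp
  | succ k ih =>
    have := hh (T^[k] x)
    rw [Function.iterate_succ_apply']
    push_cast
    linarith

end HemiMetric

/-- maximin characterisation of the escape rate: Let `(X, δ)` be a
complete metrically star-shaped hemi-metric space and `T : X → X` non-expansive.
Then `inf_y δ(y, T(y)) = ρ(T) = max_{h ∈ 𝓜} inf_x (h(T(x)) − h(x))`, the maximum
over the Martin space `𝓜` (closure, for pointwise convergence, of the functions
`i(z) : y ↦ δ(b,z) − δ(y,z)`) being attained.  The middle equality is expressed by
the convergence of `δ(x, T^k(x))/k` to `inf_y δ(y, T(y))`; the maximum is expressed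
by: some `h ∈ 𝓜` satisfies `h(T(x)) − h(x) ≥ inf_y δ(y, T(y))` for all `x`, while
for every `g ∈ 𝓜`, any lower bound of `x ↦ g(T(x)) − g(x)` is at most
`inf_y δ(y, T(y))`.  Moreover, if `δ` is bounded from below and `ρ(T) > 0`, any
Martin function attaining the maximum is a horofunction. -/
theorem maximin_escape_rate {X : Type*} [MetricSpace X] [CompleteSpace X]
    (δ : X → X → ℝ)
    (htri : ∀ x y z : X, δ x z ≤ δ x y + δ y z)
    (hsep : ∀ x y : X, (δ x y = 0 ∧ δ y x = 0) ↔ x = y)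
    (hdist : ∀ x y : X, dist x y = max (δ x y) (δ y x))
    (x₀ : X) (γ : X → ℝ → X)
    (hγ0 : ∀ y : X, γ y 0 = x₀)
    (hγ1 : ∀ y : X, γ y 1 = y)
    (hgeo : ∀ (y : X) (s t : ℝ), 0 ≤ s → s ≤ t → t ≤ 1 →
      δ (γ y s) (γ y t) = (t - s) * δ x₀ y)
    (hconv : ∀ (y z : X) (s : ℝ), 0 ≤ s → s ≤ 1 → δ (γ y s) (γ z s) ≤ s * δ y z)
    (hend : ∀ y : X, Tendsto (fun s : ℝ => δ y (γ y s)) (𝓝[<] (1 : ℝ)) (𝓝 0))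
    (T : X → X) (hT : ∀ x y : X, δ (T x) (T y) ≤ δ x y)
    (b : X) :
    (∀ x : X, Tendsto (fun k : ℕ => δ x (T^[k] x) / (k : ℝ)) atTop
        (𝓝 (⨅ y : X, δ y (T y)))) ∧
    (∃ h ∈ closure {f : X → ℝ | ∃ z : X, f = fun y => δ b z - δ y z},
        ∀ x : X, (⨅ y : X, δ y (T y)) ≤ h (T x) - h x) ∧
    (∀ g ∈ closure {f : X → ℝ | ∃ z : X, f = fun y => δ b z - δ y z},
        ∀ c : ℝ, (∀ x : X, c ≤ g (T x) - g x) → c ≤ ⨅ y : X, δ y (T y)) ∧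
    ((∃ c : ℝ, ∀ x y : X, c ≤ δ x y) → (0 < ⨅ y : X, δ y (T y)) →
      ∀ h ∈ closure {f : X → ℝ | ∃ z : X, f = fun y => δ b z - δ y z},
        (∀ x : X, (⨅ y : X, δ y (T y)) ≤ h (T x) - h x) →
        ∀ z : X, h ≠ fun y => δ b z - δ y z) := by
  have hself : ∀ x, δ x x = 0 := fun x => ((hsep x x).2 rfl).1
  have : Nonempty X := ⟨b⟩
  have hbdd := bddBelow_hemi_displacement htri hself hT b
  obtain ⟨h, hmem, hh⟩ : ∃ h ∈ closure {f : X → ℝ | ∃ z : X, f = fun y => δ b z - δ y z},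
      ∀ x : X, (⨅ y : X, δ y (T y)) ≤ h (T x) - h x := by
    have hfix : ∀ s : ℝ, ∃ w, 0 ≤ s → s < 1 → γ (T w) s = w := fun s => by
      by_cases hs : 0 ≤ s ∧ s < 1
      · obtain ⟨w, hw⟩ := exists_fixedPoint_of_hemi_contraction hdist hs.1 hs.2
          (F := fun y => γ (T y) s) fun x y => (hconv _ _ s hs.1 hs.2.le).trans
            (mul_le_mul_of_nonneg_left (hT x y) hs.1)
        exact ⟨w, fun _ _ => hw⟩
      · exact ⟨b, fun h0 h1 => absurd ⟨h0, h1⟩ hs⟩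
    choose w hw using hfix
    have hU : (Ultrafilter.of (𝓝[<] (1 : ℝ)) : Filter ℝ) ≤ 𝓝[<] 1 := Ultrafilter.of_le _
    obtain ⟨h, hmem, hlim⟩ := exists_martin_tendsto htri b (Ultrafilter.of (𝓝[<] (1 : ℝ))) w
    refine ⟨h, hmem, fun x => ?_⟩
    have hs : Tendsto (fun s : ℝ => s) (Ultrafilter.of (𝓝[<] (1 : ℝ))) (𝓝 1) :=
      hU.trans nhdsWithin_le_nhds
    have hleft := ((hs.mul_const (⨅ y : X, δ y (T y))).sub
      ((hs.const_sub 1).mul_const (δ x₀ x))).sub ((hend (T x)).mono_left hU)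
    simp only [one_mul, sub_self, zero_mul, sub_zero] at hleft
    refine le_of_tendsto_of_tendsto hleft ((hlim (T x)).sub (hlim x)) ?_
    have hI : ∀ᶠ s in 𝓝[<] (1 : ℝ), s ∈ Set.Ioo (0 : ℝ) 1 := Ioo_mem_nhdsLT one_pos
    filter_upwards [hU hI] with s hs
    have h₁ := hemi_fixedPoint_sub_ge htri hγ0 hγ1 hgeo hconv hT hs.1.le hs.2.le
      (hw s hs.1.le hs.2) x
    have h₂ := mul_le_mul_of_nonneg_left (ciInf_le hbdd (w s)) hs.1.le
    linarith
  refine ⟨fun x => ?_, ⟨h, hmem, hh⟩, fun g hg c hc => ?_, ?_⟩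
  · refine tendsto_order.2 ⟨fun a ha => ?_, fun a ha => ?_⟩
    · filter_upwards [eventually_gt_atTop 0] with k hk
      refine ha.trans_le ?_
      rw [le_div_iff₀ (Nat.cast_pos.2 hk), mul_comm]
      exact (mul_le_sub_iterate hh x k).trans (martin_sub_le htri hmem _ _)
    · obtain ⟨y, hy⟩ := exists_lt_of_ciInf_lt ha
      have hlim : Tendsto (fun k : ℕ => δ y (T y) + (δ x y + δ y x) / (k : ℝ)) atTop
          (𝓝 (δ y (T y))) := by
        simpa using (tendsto_const_div_atTop_nhds_zero_nat (δ x y + δ y x)).const_add (δ y (T y))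
      filter_upwards [eventually_gt_atTop 0, hlim.eventually_lt_const hy] with k hk hlt
      have hk' : (0 : ℝ) < k := Nat.cast_pos.2 hk
      refine lt_of_le_of_lt ?_ hlt
      rw [div_le_iff₀ hk', add_mul, div_mul_cancel₀ _ hk'.ne', mul_comm]
      exact hemi_orbit_le htri hself hT x y k
  · exact le_ciInf fun y => (hc y).trans (martin_sub_le htri hg _ _)
  · rintro ⟨c, hc⟩ hpos f - hf z rfl
    obtain ⟨k, hk⟩ := exists_nat_gt (-c / ⨅ y : X, δ y (T y))
    rw [div_lt_iff₀ hpos] at hk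
    have h₁ := mul_le_sub_iterate (h := fun y => δ b z - δ y z) hf z k
    have h₂ := hc (T^[k] z) z
    have h₃ := hself z
    linarith
end

section
/- Let C be a closed, convex and pointed cone with nonempty interior in ℝⁿ, let T : int C → int C be order-preserving and sub-homogeneous, and let T̂ : C → C be its radial extension, characterized by T̂(x) = lim_{ε→0⁺} T(x + εz) for every x ∈ C and every z ∈ int C. Fix a basepoint b ∈ int C, let u ∈ C \ {0}, and let h(x) = −RFunk(x,u) + RFunk(b,u) for x ∈ int C. Then for every λ ∈ ℝ: (h(T(x)) − h(x) ≥ λ for all x ∈ int C) if and only if (T̂(γu) ≥ γ·exp(λ)·u for all γ > 0). -/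
open Filter Topology

/-- `M(y/x) = inf {λ > 0 | λ • x − y ∈ C}`. -/
noncomputable def MFunk {n : ℕ} (C : Set (EuclideanSpace ℝ (Fin n)))
    (x y : EuclideanSpace ℝ (Fin n)) : ℝ :=
  sInf {l : ℝ | 0 < l ∧ l • x - y ∈ C}

/-- The reverse Funk hemi-metric `RFunk(x,y) = log M(y/x)`. -/
noncomputable def RFunk {n : ℕ} (C : Set (EuclideanSpace ℝ (Fin n)))
    (x y : EuclideanSpace ℝ (Fin n)) : ℝ :=
  Real.log (MFunk C x y)

section ConvexCone

variable {E : Type*} [NormedAddCommGroup E] [NormedSpace ℝ E] {C : Set E}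

lemma Convex.add_mem_of_smul_mem (hconv : Convex ℝ C)
    (hcone : ∀ x ∈ C, ∀ t : ℝ, 0 ≤ t → t • x ∈ C) {x y : E} (hx : x ∈ C) (hy : y ∈ C) :
    x + y ∈ C := by
  have h := hcone _ (hconv hx hy (by norm_num : (0 : ℝ) ≤ 1 / 2)
    (by norm_num : (0 : ℝ) ≤ 1 / 2) (by norm_num)) 2 (by norm_num)
  rw [smul_add, smul_smul, smul_smul] at h
  norm_num at h
  exact h

lemma Convex.add_mem_interior_of_smul_mem (hconv : Convex ℝ C)
    (hcone : ∀ x ∈ C, ∀ t : ℝ, 0 ≤ t → t • x ∈ C) {x z : E} (hx : x ∈ C)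
    (hz : z ∈ interior C) : x + z ∈ interior C := by
  refine mem_interior.2 ⟨(fun y => x + y) '' interior C, ?_,
    isOpenMap_add_left x _ isOpen_interior, z, hz, rfl⟩
  rintro _ ⟨y, hy, rfl⟩
  exact hconv.add_mem_of_smul_mem hcone hx (interior_subset hy)

lemma smul_mem_interior_of_smul_mem (hcone : ∀ x ∈ C, ∀ t : ℝ, 0 ≤ t → t • x ∈ C)
    {z : E} (hz : z ∈ interior C) {t : ℝ} (ht : 0 < t) : t • z ∈ interior C := by
  refine mem_interior.2 ⟨(fun y => t • y) '' interior C, ?_,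
    isOpenMap_smul₀ ht.ne' _ isOpen_interior, z, hz, rfl⟩
  rintro _ ⟨y, hy, rfl⟩
  exact hcone _ (interior_subset hy) t ht.le

lemma exists_pos_smul_sub_mem_of_mem_interior
    (hcone : ∀ x ∈ C, ∀ t : ℝ, 0 ≤ t → t • x ∈ C) {x : E} (hx : x ∈ interior C) (u : E) :
    ∃ l : ℝ, 0 < l ∧ l • x - u ∈ C := by
  have hlim : Tendsto (fun ε : ℝ => x - ε • u) (𝓝[>] (0 : ℝ)) (𝓝 x) := by
    have hc : Continuous fun ε : ℝ => x - ε • u := by fun_prop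
    simpa using (hc.tendsto 0).mono_left nhdsWithin_le_nhds
  obtain ⟨ε, hε, hpos⟩ :=
    ((hlim.eventually (mem_interior_iff_mem_nhds.1 hx)).and self_mem_nhdsWithin).exists
  have hpos' : (0 : ℝ) < ε := hpos
  refine ⟨ε⁻¹, inv_pos.2 hpos', ?_⟩
  have h := hcone _ hε ε⁻¹ (inv_pos.2 hpos').le
  rwa [smul_sub, smul_smul, inv_mul_cancel₀ hpos'.ne', one_smul] at h

end ConvexCone

section MFunk

variable {n : ℕ} {C : Set (EuclideanSpace ℝ (Fin n))} {x u : EuclideanSpace ℝ (Fin n)}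

lemma MFunk_le {l : ℝ} (hl : 0 < l) (h : l • x - u ∈ C) : MFunk C x u ≤ l :=
  csInf_le ⟨0, fun _ hm => hm.1.le⟩ ⟨hl, h⟩

lemma MFunk_pos_and_smul_sub_mem (hclosed : IsClosed C)
    (hcone : ∀ x ∈ C, ∀ t : ℝ, 0 ≤ t → t • x ∈ C)
    (hpointed : ∀ x ∈ C, -x ∈ C → x = 0) (hx : x ∈ interior C) (hu : u ∈ C) (hu0 : u ≠ 0) :
    0 < MFunk C x u ∧ MFunk C x u • x - u ∈ C := by
  have hset : {l : ℝ | 0 < l ∧ l • x - u ∈ C} = {l : ℝ | 0 ≤ l ∧ l • x - u ∈ C} := by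
    ext l
    refine ⟨fun h => ⟨h.1.le, h.2⟩, fun h => ⟨h.1.lt_of_ne ?_, h.2⟩⟩
    rintro rfl
    exact hu0 (hpointed u hu (by simpa using h.2))
  have hcl : IsClosed {l : ℝ | 0 < l ∧ l • x - u ∈ C} := by
    rw [hset]
    exact isClosed_Ici.inter (hclosed.preimage (by fun_prop : Continuous fun l : ℝ => l • x - u))
  exact hcl.csInf_mem (exists_pos_smul_sub_mem_of_mem_interior hcone hx u)
    ⟨0, fun _ hm => hm.1.le⟩

lemma smul_sub_mem_of_MFunk_le (hclosed : IsClosed C) (hconv : Convex ℝ C)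
    (hcone : ∀ x ∈ C, ∀ t : ℝ, 0 ≤ t → t • x ∈ C)
    (hpointed : ∀ x ∈ C, -x ∈ C → x = 0) (hx : x ∈ interior C) (hu : u ∈ C) (hu0 : u ≠ 0)
    {l : ℝ} (hl : MFunk C x u ≤ l) : l • x - u ∈ C := by
  have h := hconv.add_mem_of_smul_mem hcone
    (MFunk_pos_and_smul_sub_mem hclosed hcone hpointed hx hu hu0).2
    (hcone x (interior_subset hx) (l - MFunk C x u) (sub_nonneg.2 hl))
  convert h using 1
  module

lemma MFunk_le_inv_iff (hclosed : IsClosed C) (hconv : Convex ℝ C)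
    (hcone : ∀ x ∈ C, ∀ t : ℝ, 0 ≤ t → t • x ∈ C)
    (hpointed : ∀ x ∈ C, -x ∈ C → x = 0) (hx : x ∈ interior C) (hu : u ∈ C) (hu0 : u ≠ 0)
    {c : ℝ} (hc : 0 < c) : MFunk C x u ≤ c⁻¹ ↔ x - c • u ∈ C := by
  constructor
  · intro h
    have h' := hcone _
      (smul_sub_mem_of_MFunk_le hclosed hconv hcone hpointed hx hu hu0 h) c hc.le
    rwa [smul_sub, smul_smul, mul_inv_cancel₀ hc.ne', one_smul] at h'
  · intro h
    refine MFunk_le (inv_pos.2 hc) ?_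
    have h' := hcone _ h c⁻¹ (inv_pos.2 hc).le
    rwa [smul_sub, smul_smul, inv_mul_cancel₀ hc.ne', one_smul] at h'

end MFunk

/-- Let `C` be a closed, convex, pointed cone with nonempty interior
in `ℝⁿ`, `T` an order-preserving sub-homogeneous self-map of `int C`, and `T̂` its
radial extension, characterised by `T̂(x) = lim_{ε→0⁺} T(x + ε z)` for every
`x ∈ C` and `z ∈ int C`.  Fix `b ∈ int C`, `u ∈ C \ {0}` and let
`h(x) = −RFunk(x,u) + RFunk(b,u)`.  Then for every `λ ∈ ℝ`:
`(∀ x ∈ int C, h(T(x)) − h(x) ≥ λ)` iff `(∀ γ > 0, T̂(γ•u) ≥ γ·exp(λ)·u)`. -/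
theorem martin_function_cw_lemma {n : ℕ} (C : Set (EuclideanSpace ℝ (Fin n)))
    (hclosed : IsClosed C) (hconv : Convex ℝ C)
    (hcone : ∀ x ∈ C, ∀ t : ℝ, 0 ≤ t → t • x ∈ C)
    (hpointed : ∀ x ∈ C, -x ∈ C → x = 0)
    (hint : (interior C).Nonempty)
    (T : EuclideanSpace ℝ (Fin n) → EuclideanSpace ℝ (Fin n))
    (hTmaps : Set.MapsTo T (interior C) (interior C))
    (hTmono : ∀ x ∈ interior C, ∀ y ∈ interior C, y - x ∈ C → T y - T x ∈ C)
    (hTsub : ∀ l : ℝ, 1 ≤ l → ∀ x ∈ interior C, l • T x - T (l • x) ∈ C)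
    (That : EuclideanSpace ℝ (Fin n) → EuclideanSpace ℝ (Fin n))
    (hThatmaps : Set.MapsTo That C C)
    (hThat : ∀ x ∈ C, ∀ z ∈ interior C,
      Tendsto (fun ε : ℝ => T (x + ε • z)) (𝓝[>] (0 : ℝ)) (𝓝 (That x)))
    (b : EuclideanSpace ℝ (Fin n)) (hb : b ∈ interior C)
    (u : EuclideanSpace ℝ (Fin n)) (hu : u ∈ C) (hu0 : u ≠ 0) :
    ∀ lam : ℝ,
      (∀ x ∈ interior C,
          (-(RFunk C (T x) u) + RFunk C b u) - (-(RFunk C x u) + RFunk C b u) ≥ lam) ↔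
        (∀ γ : ℝ, 0 < γ → That (γ • u) - (γ * Real.exp lam) • u ∈ C) := by
  intro lam
  have hpos : ∀ x ∈ interior C, 0 < MFunk C x u := fun x hx =>
    (MFunk_pos_and_smul_sub_mem hclosed hcone hpointed hx hu hu0).1
  have hiff : ∀ x ∈ interior C,
      ((-(RFunk C (T x) u) + RFunk C b u) - (-(RFunk C x u) + RFunk C b u) ≥ lam ↔
        MFunk C (T x) u ≤ MFunk C x u * (Real.exp lam)⁻¹) := by
    intro x hx
    rw [← Real.exp_neg, ← Real.log_le_log_iff (hpos _ (hTmaps hx))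
      (mul_pos (hpos x hx) (Real.exp_pos _)),
      Real.log_mul (hpos x hx).ne' (Real.exp_pos _).ne', Real.log_exp]
    unfold RFunk
    constructor <;> intro h <;> linarith
  constructor
  · intro h γ hγ
    have hγu : γ • u ∈ C := hcone u hu γ hγ.le
    refine hclosed.mem_of_tendsto ((hThat _ hγu b hb).sub_const ((γ * Real.exp lam) • u)) ?_
    filter_upwards [self_mem_nhdsWithin] with ε hε
    have hεb := smul_mem_interior_of_smul_mem hcone hb hε
    have hx := hconv.add_mem_interior_of_smul_mem hcone hγu hεb
    have hMx : MFunk C (γ • u + ε • b) u ≤ γ⁻¹ := by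
      rw [MFunk_le_inv_iff hclosed hconv hcone hpointed hx hu hu0 hγ, add_sub_cancel_left]
      exact interior_subset hεb
    rw [← MFunk_le_inv_iff hclosed hconv hcone hpointed (hTmaps hx) hu hu0
      (mul_pos hγ (Real.exp_pos lam)), mul_inv]
    refine ((hiff _ hx).1 (h _ hx)).trans ?_
    gcongr
  · intro h x hx
    rw [hiff x hx]
    set γ := (MFunk C x u)⁻¹ with hγdef
    have hγ : 0 < γ := inv_pos.2 (hpos x hx)
    have hγu : γ • u ∈ C := hcone u hu γ hγ.le
    have hxγ : x - γ • u ∈ C := by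
      rw [← MFunk_le_inv_iff hclosed hconv hcone hpointed hx hu hu0 hγ, hγdef, inv_inv]
    have hThat_le : T x - That (γ • u) ∈ C := by
      have hlim : Tendsto (fun ε : ℝ => (1 + ε) • T x - T (γ • u + ε • x)) (𝓝[>] (0 : ℝ))
          (𝓝 (T x - That (γ • u))) := by
        refine Tendsto.sub ?_ (hThat _ hγu x hx)
        have hc : Continuous fun ε : ℝ => (1 + ε) • T x := by fun_prop
        simpa using (hc.tendsto 0).mono_left nhdsWithin_le_nhds
      refine hclosed.mem_of_tendsto hlim ?_
      filter_upwards [self_mem_nhdsWithin] with ε hε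
      have hε' : (0 : ℝ) < ε := hε
      have hy := hconv.add_mem_interior_of_smul_mem hcone hγu
        (smul_mem_interior_of_smul_mem hcone hx hε')
      have hmono := hTmono _ hy _
        (smul_mem_interior_of_smul_mem hcone hx (by linarith : (0 : ℝ) < 1 + ε))
        (by convert hxγ using 1; module)
      have hsub := hTsub (1 + ε) (by linarith) x hx
      simpa using hconv.add_mem_of_smul_mem hcone hsub hmono
    rw [← inv_inv (MFunk C x u), ← hγdef, ← mul_inv,
      MFunk_le_inv_iff hclosed hconv hcone hpointed (hTmaps hx) hu hu0
        (mul_pos hγ (Real.exp_pos lam))]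
    simpa using hconv.add_mem_of_smul_mem hcone hThat_le (h γ hγ)
end
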